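/- arXiv:1312.6816 — 3 statements merged into one kernel-verified Lean document; each statement's English description precedes it below -/
import Mathlib

section
/- For all λ₁, λ₂ ∈ ℂ, the six-vertex monodromy matrix satisfies the RTT relation R₁₂(λ₁−λ₂) T₁(λ₁) T₂(λ₂) = T₂(λ₂) T₁(λ₁) R₁₂(λ₁−λ₂) as operators on ℂ² ⊗ ℂ² ⊗ (ℂ²)^{⊗L}, where R₁₂(λ) acts as R(λ) on the two auxiliary factors and as the identity on (ℂ²)^{⊗L}, and T₁(λ) (resp. T₂(λ)) acts as T(λ) on the first (resp. second) auxiliary factor together with the quantum space (ℂ²)^{⊗L}, and as the identity on the other auxiliary factor. -/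
noncomputable section

/-- `a(λ) = sinh(λ + γ)` -/
def af (γ lam : ℂ) : ℂ := Complex.sinh (lam + γ)

/-- `b(λ) = sinh(λ)` -/
def bf (lam : ℂ) : ℂ := Complex.sinh lam

/-- `c(λ) = sinh(γ)` (a constant function of `λ`). -/
def cf (γ : ℂ) (_lam : ℂ) : ℂ := Complex.sinh γ

/-- The six-vertex R-matrix on `ℂ² ⊗ ℂ²`, in the ordered basis
`(e₁⊗e₁, e₁⊗e₂, e₂⊗e₁, e₂⊗e₂)` encoded by pairs `(i, j) : Fin 2 × Fin 2`. -/
def Rmat (γ lam : ℂ) : Matrix (Fin 2 × Fin 2) (Fin 2 × Fin 2) ℂ :=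
  fun p q =>
    if p = q then (if p.1 = p.2 then af γ lam else bf lam)
    else if p.1 = q.2 ∧ p.2 = q.1 then cf γ lam else 0

/-- `R_{ai}(λ)` on `ℂ² ⊗ (ℂ²)^{⊗L}`: `R(λ)` on the auxiliary factor and the
`i`-th quantum factor, identity elsewhere.  A vector of the space is indexed by
a pair `(auxiliary index, quantum indices)`. -/
def Rai (γ : ℂ) {L : ℕ} (lam : ℂ) (i : Fin L) :
    Matrix (Fin 2 × (Fin L → Fin 2)) (Fin 2 × (Fin L → Fin 2)) ℂ :=
  fun p q =>
    Rmat γ lam (p.1, p.2 i) (q.1, q.2 i) *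
      (if ∀ k, k ≠ i → p.2 k = q.2 k then 1 else 0)

/-- The monodromy matrix `T(λ) = R_{a1}(λ−μ₁) R_{a2}(λ−μ₂) ⋯ R_{aL}(λ−μ_L)`. -/
def Tmat (γ : ℂ) {L : ℕ} (μ : Fin L → ℂ) (lam : ℂ) :
    Matrix (Fin 2 × (Fin L → Fin 2)) (Fin 2 × (Fin L → Fin 2)) ℂ :=
  (List.ofFn fun i : Fin L => Rai γ (lam - μ i) i).prod

/-- `A(λ)`: the (1,1) block of `T(λ)` with respect to the auxiliary factor. -/
def Aop (γ : ℂ) {L : ℕ} (μ : Fin L → ℂ) (lam : ℂ) :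
    Matrix (Fin L → Fin 2) (Fin L → Fin 2) ℂ :=
  fun p q => Tmat γ μ lam (0, p) (0, q)

/-- `B(λ)`: the (1,2) block of `T(λ)` with respect to the auxiliary factor. -/
def Bop (γ : ℂ) {L : ℕ} (μ : Fin L → ℂ) (lam : ℂ) :
    Matrix (Fin L → Fin 2) (Fin L → Fin 2) ℂ :=
  fun p q => Tmat γ μ lam (0, p) (1, q)

/-- `C(λ)`: the (2,1) block of `T(λ)` with respect to the auxiliary factor. -/
def Cop (γ : ℂ) {L : ℕ} (μ : Fin L → ℂ) (lam : ℂ) :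
    Matrix (Fin L → Fin 2) (Fin L → Fin 2) ℂ :=
  fun p q => Tmat γ μ lam (1, p) (0, q)

/-- `D(λ)`: the (2,2) block of `T(λ)` with respect to the auxiliary factor. -/
def Dop (γ : ℂ) {L : ℕ} (μ : Fin L → ℂ) (lam : ℂ) :
    Matrix (Fin L → Fin 2) (Fin L → Fin 2) ℂ :=
  fun p q => Tmat γ μ lam (1, p) (1, q)

/-- The vector `|0⟩ = e₁^{⊗L}`. -/
def v0 {L : ℕ} : (Fin L → Fin 2) → ℂ :=
  fun p => if p = (fun _ => 0) then 1 else 0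

/-- The vector `|0̄⟩ = e₂^{⊗L}`. -/
def v0bar {L : ℕ} : (Fin L → Fin 2) → ℂ :=
  fun p => if p = (fun _ => 1) then 1 else 0

/-- `R₁₂(λ)` on `ℂ² ⊗ ℂ² ⊗ (ℂ²)^{⊗L}`: `R(λ)` on the two auxiliary factors,
identity on the quantum space. -/
def R12T (γ : ℂ) {L : ℕ} (lam : ℂ) :
    Matrix (Fin 2 × Fin 2 × (Fin L → Fin 2)) (Fin 2 × Fin 2 × (Fin L → Fin 2)) ℂ :=
  fun p q => Rmat γ lam (p.1, p.2.1) (q.1, q.2.1) * (if p.2.2 = q.2.2 then 1 else 0)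

/-- `T₁(λ)`: `T(λ)` on the first auxiliary factor and the quantum space,
identity on the second auxiliary factor. -/
def T1 (γ : ℂ) {L : ℕ} (μ : Fin L → ℂ) (lam : ℂ) :
    Matrix (Fin 2 × Fin 2 × (Fin L → Fin 2)) (Fin 2 × Fin 2 × (Fin L → Fin 2)) ℂ :=
  fun p q => Tmat γ μ lam (p.1, p.2.2) (q.1, q.2.2) * (if p.2.1 = q.2.1 then 1 else 0)

/-- `T₂(λ)`: `T(λ)` on the second auxiliary factor and the quantum space,
identity on the first auxiliary factor. -/
def T2 (γ : ℂ) {L : ℕ} (μ : Fin L → ℂ) (lam : ℂ) :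
    Matrix (Fin 2 × Fin 2 × (Fin L → Fin 2)) (Fin 2 × Fin 2 × (Fin L → Fin 2)) ℂ :=
  fun p q => Tmat γ μ lam (p.2.1, p.2.2) (q.2.1, q.2.2) * (if p.1 = q.1 then 1 else 0)

/-- Embedding acting on aux 1 and the quantum space. -/
def E1 {L : ℕ} (M : Matrix (Fin 2 × (Fin L → Fin 2)) (Fin 2 × (Fin L → Fin 2)) ℂ) :
    Matrix (Fin 2 × Fin 2 × (Fin L → Fin 2)) (Fin 2 × Fin 2 × (Fin L → Fin 2)) ℂ :=
  fun p q => M (p.1, p.2.2) (q.1, q.2.2) * (if p.2.1 = q.2.1 then 1 else 0)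

/-- Embedding acting on aux 2 and the quantum space. -/
def E2 {L : ℕ} (M : Matrix (Fin 2 × (Fin L → Fin 2)) (Fin 2 × (Fin L → Fin 2)) ℂ) :
    Matrix (Fin 2 × Fin 2 × (Fin L → Fin 2)) (Fin 2 × Fin 2 × (Fin L → Fin 2)) ℂ :=
  fun p q => M (p.2.1, p.2.2) (q.2.1, q.2.2) * (if p.1 = q.1 then 1 else 0)

lemma E1_one {L : ℕ} : E1 (L := L) 1 = 1 := by
  ext ⟨a, b, p⟩ ⟨c, d, q⟩
  simp only [E1, Matrix.one_apply, Prod.mk.injEq]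
  by_cases h1 : a = c <;> by_cases h2 : b = d <;> by_cases h3 : p = q <;> simp [h1, h2, h3]

lemma E2_one {L : ℕ} : E2 (L := L) 1 = 1 := by
  ext ⟨a, b, p⟩ ⟨c, d, q⟩
  simp only [E2, Matrix.one_apply, Prod.mk.injEq]
  by_cases h1 : a = c <;> by_cases h2 : b = d <;> by_cases h3 : p = q <;> simp [h1, h2, h3]

lemma E1_mul {L : ℕ} (M N : Matrix (Fin 2 × (Fin L → Fin 2)) (Fin 2 × (Fin L → Fin 2)) ℂ) :
    E1 (M * N) = E1 M * E1 N := by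
  ext ⟨a, b, p⟩ ⟨c, d, q⟩
  simp only [E1, Matrix.mul_apply, Fintype.sum_prod_type]
  by_cases h : b = d
  · subst h
    simp only [if_true, mul_one]
    refine Finset.sum_congr rfl fun x _ => ?_
    rw [Finset.sum_eq_single b]
    · simp
    · intro y _ hy; simp [hy]
    · simp
  · simp only [h, if_false, mul_zero]
    symm
    refine Finset.sum_eq_zero fun x _ => Finset.sum_eq_zero fun y _ => Finset.sum_eq_zero fun r _ => ?_
    by_cases hy : b = y
    · subst hy; simp [h]
    · simp [hy]

lemma E2_mul {L : ℕ} (M N : Matrix (Fin 2 × (Fin L → Fin 2)) (Fin 2 × (Fin L → Fin 2)) ℂ) :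
    E2 (M * N) = E2 M * E2 N := by
  ext ⟨a, b, p⟩ ⟨c, d, q⟩
  simp only [E2, Matrix.mul_apply, Fintype.sum_prod_type]
  by_cases h : a = c
  · subst h
    simp only [if_true, mul_one]
    symm
    rw [Finset.sum_eq_single a]
    · simp
    · intro y _ hy; simp [hy]
    · simp
  · simp only [h, if_false, mul_zero]
    symm
    refine Finset.sum_eq_zero fun x _ => Finset.sum_eq_zero fun y _ => Finset.sum_eq_zero fun r _ => ?_
    by_cases hy : a = x
    · subst hy; simp [h]
    · simp [hy]

/-- Embedding of an operator on three factors: both auxiliary ones and quantum site `i`. -/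
def emb {L : ℕ} (i : Fin L) (M : Matrix (Fin 2 × Fin 2 × Fin 2) (Fin 2 × Fin 2 × Fin 2) ℂ) :
    Matrix (Fin 2 × Fin 2 × (Fin L → Fin 2)) (Fin 2 × Fin 2 × (Fin L → Fin 2)) ℂ :=
  fun p q => M (p.1, p.2.1, p.2.2 i) (q.1, q.2.1, q.2.2 i) *
      (if ∀ k, k ≠ i → p.2.2 k = q.2.2 k then 1 else 0)

lemma sum_agree {L : ℕ} (i : Fin L) (p : Fin L → Fin 2) (f : (Fin L → Fin 2) → ℂ)
    (hf : ∀ r, (¬ ∀ k, k ≠ i → p k = r k) → f r = 0) :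
    ∑ r, f r = ∑ x, f (Function.update p i x) := by
  symm
  refine Finset.sum_of_injOn (fun x => Function.update p i x) ?_ ?_ ?_ ?_
  · intro x _ y _ h
    exact Function.update_injective p i h
  · intro x _; simp
  · intro r _ hr
    apply hf
    intro h
    apply hr
    refine ⟨r i, by simp, ?_⟩
    funext k
    by_cases hk : k = i
    · subst hk; simp
    · simp [hk, h k hk]
  · intro x _; rfl

lemma emb_mul {L : ℕ} (i : Fin L) (M N : Matrix (Fin 2 × Fin 2 × Fin 2) (Fin 2 × Fin 2 × Fin 2) ℂ) :
    emb i (M * N) = emb i M * emb i N := by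
  ext ⟨a, b, p⟩ ⟨c, d, q⟩
  simp only [emb, Matrix.mul_apply, Fintype.sum_prod_type, Finset.sum_mul]
  refine Finset.sum_congr rfl fun x _ => Finset.sum_congr rfl fun y _ => ?_
  rw [sum_agree i p]
  · refine Finset.sum_congr rfl fun z _ => ?_
    have h1 : ∀ k, k ≠ i → p k = Function.update p i z k := by
      intro k hk; simp [hk]
    have h2 : (∀ k, k ≠ i → Function.update p i z k = q k) ↔ (∀ k, k ≠ i → p k = q k) := by
      refine forall_congr' fun k => forall_congr' fun hk => ?_
      simp [hk]
    rw [if_pos h1]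
    simp only [h2, Function.update_self]
    ring
  · intro r hr
    rw [if_neg hr]; ring

/-- `R` on factors 1,2. -/
def S12 (γ u : ℂ) : Matrix (Fin 2 × Fin 2 × Fin 2) (Fin 2 × Fin 2 × Fin 2) ℂ :=
  fun p q => Rmat γ u (p.1, p.2.1) (q.1, q.2.1) * (if p.2.2 = q.2.2 then 1 else 0)
/-- `R` on factors 1,3. -/
def S13 (γ u : ℂ) : Matrix (Fin 2 × Fin 2 × Fin 2) (Fin 2 × Fin 2 × Fin 2) ℂ :=
  fun p q => Rmat γ u (p.1, p.2.2) (q.1, q.2.2) * (if p.2.1 = q.2.1 then 1 else 0)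
/-- `R` on factors 2,3. -/
def S23 (γ u : ℂ) : Matrix (Fin 2 × Fin 2 × Fin 2) (Fin 2 × Fin 2 × Fin 2) ℂ :=
  fun p q => Rmat γ u (p.2.1, p.2.2) (q.2.1, q.2.2) * (if p.1 = q.1 then 1 else 0)

lemma sinh_exp (x : ℂ) : Complex.sinh x = (Complex.exp x - (Complex.exp x)⁻¹) / 2 := by
  rw [Complex.sinh, Complex.exp_neg]

set_option maxHeartbeats 4000000 in
lemma YBE (γ u v : ℂ) :
    S12 γ (u - v) * S13 γ u * S23 γ v = S23 γ v * S13 γ u * S12 γ (u - v) := by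
  ext ⟨a, b, c⟩ ⟨d, e, f⟩
  have hu := Complex.exp_ne_zero u
  have hv := Complex.exp_ne_zero v
  have hg := Complex.exp_ne_zero γ
  fin_cases a <;> fin_cases b <;> fin_cases c <;> fin_cases d <;> fin_cases e <;> fin_cases f <;>
    simp [Matrix.mul_apply, Fintype.sum_prod_type, Fin.sum_univ_two, S12, S13, S23, Rmat] <;>
    simp only [af, bf, cf, sinh_exp, Complex.exp_add, Complex.exp_sub] <;>
    field_simp <;> ring

lemma R12_emb (γ u : ℂ) {L : ℕ} (i : Fin L) : R12T γ u = emb i (S12 γ u) := by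
  ext ⟨a, b, p⟩ ⟨c, d, q⟩
  have : p = q ↔ (p i = q i ∧ ∀ k, k ≠ i → p k = q k) := by
    constructor
    · rintro rfl; simp
    · rintro ⟨h1, h2⟩; funext k
      by_cases hk : k = i
      · subst hk; exact h1
      · exact h2 k hk
  simp only [R12T, emb, S12, this, ite_and]
  split_ifs <;> simp

lemma R1_emb (γ u : ℂ) {L : ℕ} (i : Fin L) : E1 (Rai γ u i) = emb i (S13 γ u) := by
  ext ⟨a, b, p⟩ ⟨c, d, q⟩
  simp only [E1, Rai, emb, S13]
  ring

lemma R2_emb (γ u : ℂ) {L : ℕ} (i : Fin L) : E2 (Rai γ u i) = emb i (S23 γ u) := by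
  ext ⟨a, b, p⟩ ⟨c, d, q⟩
  simp only [E2, Rai, emb, S23]
  ring

lemma local_YBE (γ u v w : ℂ) (hw : w = u - v) {L : ℕ} (i : Fin L) :
    R12T γ w * E1 (Rai γ u i) * E2 (Rai γ v i) = E2 (Rai γ v i) * E1 (Rai γ u i) * R12T γ w := by
  rw [R12_emb γ w i, R1_emb, R2_emb, ← emb_mul, ← emb_mul, ← emb_mul, ← emb_mul, hw, YBE]

lemma local_comm (γ u v : ℂ) {L : ℕ} (i j : Fin L) (hij : i ≠ j) :
    E1 (Rai γ u i) * E2 (Rai γ v j) = E2 (Rai γ v j) * E1 (Rai γ u i) := by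
  ext ⟨a, b, p⟩ ⟨c, d, q⟩
  have e2 : (∀ k, k ≠ j → Function.update p i (q i) k = q k) ↔ ∀ k, k ≠ i → k ≠ j → p k = q k := by
    refine forall_congr' fun k => ?_
    by_cases hk : k = i
    · subst hk; simp
    · simp [hk]
  have e3 : (∀ k, k ≠ i → Function.update p j (q j) k = q k) ↔ ∀ k, k ≠ i → k ≠ j → p k = q k := by
    refine forall_congr' fun k => ?_
    by_cases hk : k = j
    · subst hk; simp
    · simp [hk]
  have e0 : ∀ (i : Fin L) (x : Fin 2), (∀ k, k ≠ i → p k = Function.update p i x k) := by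
    intro i x k hk; simp [hk]
  simp only [Matrix.mul_apply]
  rw [Finset.sum_eq_single (c, b, Function.update p i (q i)),
    Finset.sum_eq_single (a, d, Function.update p j (q j))]
  · simp only [E1, E2, Rai, e2, e3, if_pos (e0 _ _), Function.update_self, if_true,
      Function.update_of_ne hij, Function.update_of_ne hij.symm]
    ring
  · rintro ⟨x, y, r⟩ _ hr
    simp only [E1, E2, Rai]
    by_contra hne
    simp only [mul_eq_zero, ite_eq_right_iff, one_ne_zero, imp_false, not_or, not_not] at hne
    obtain ⟨⟨⟨-, h1⟩, h2⟩, ⟨-, h3⟩, h4⟩ := hne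
    apply hr
    refine Prod.ext h2.symm (Prod.ext h4 ?_)
    funext k
    by_cases hk : k = j
    · subst hk; simpa using h3 k hij.symm
    · simpa [hk] using (h1 k hk).symm
  · simp
  · rintro ⟨x, y, r⟩ _ hr
    simp only [E1, E2, Rai]
    by_contra hne
    simp only [mul_eq_zero, ite_eq_right_iff, one_ne_zero, imp_false, not_or, not_not] at hne
    obtain ⟨⟨⟨-, h1⟩, h2⟩, ⟨-, h3⟩, h4⟩ := hne
    apply hr
    refine Prod.ext h4 (Prod.ext h2.symm ?_)
    funext k
    by_cases hk : k = i
    · subst hk; simpa using h3 k hij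
    · simpa [hk] using (h1 k hk).symm
  · simp

lemma train {M ι : Type*} [Monoid M] (R : M) (A B : ι → M)
    (h : ∀ i, R * A i * B i = B i * A i * R)
    (hc : ∀ i j, i ≠ j → A i * B j = B j * A i) (l : List ι) (hl : l.Nodup) :
    R * (l.map A).prod * (l.map B).prod = (l.map B).prod * (l.map A).prod * R := by
  induction l with
  | nil => simp
  | cons i l ih =>
    rw [List.nodup_cons] at hl
    have c1 : Commute (B i) (l.map A).prod := by
      apply Commute.list_prod_right
      intro x hx
      obtain ⟨j, hj, rfl⟩ := List.mem_map.1 hx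
      exact (hc j i (by rintro rfl; exact hl.1 hj)).symm
    have c2 : Commute (A i) (l.map B).prod := by
      apply Commute.list_prod_right
      intro x hx
      obtain ⟨j, hj, rfl⟩ := List.mem_map.1 hx
      exact hc i j (by rintro rfl; exact hl.1 hj)
    have ih := ih hl.2
    simp only [List.map_cons, List.prod_cons]
    set PA := (l.map A).prod
    set PB := (l.map B).prod
    calc R * (A i * PA) * (B i * PB) = R * A i * (PA * B i) * PB := by simp only [mul_assoc]
      _ = (R * A i * B i) * PA * PB := by rw [← c1.eq]; simp only [mul_assoc]
      _ = B i * A i * (R * PA * PB) := by rw [h]; simp only [mul_assoc]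
      _ = B i * (A i * PB) * PA * R := by rw [ih]; simp only [mul_assoc]
      _ = _ := by rw [c2.eq]; simp only [mul_assoc]

lemma T1_eq (γ : ℂ) {L : ℕ} (μ : Fin L → ℂ) (l1 : ℂ) :
    T1 γ μ l1 = ((List.finRange L).map fun i => E1 (Rai γ (l1 - μ i) i)).prod := by
  have h : T1 γ μ l1 = E1 (Tmat γ μ l1) := rfl
  rw [h, Tmat, List.ofFn_eq_map]
  induction List.finRange L with
  | nil => simpa using E1_one
  | cons i l ih => simp only [List.map_cons, List.prod_cons, E1_mul, ih]

lemma T2_eq (γ : ℂ) {L : ℕ} (μ : Fin L → ℂ) (l1 : ℂ) :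
    T2 γ μ l1 = ((List.finRange L).map fun i => E2 (Rai γ (l1 - μ i) i)).prod := by
  have h : T2 γ μ l1 = E2 (Tmat γ μ l1) := rfl
  rw [h, Tmat, List.ofFn_eq_map]
  induction List.finRange L with
  | nil => simpa using E2_one
  | cons i l ih => simp only [List.map_cons, List.prod_cons, E2_mul, ih]

/-- The RTT relation for the six-vertex monodromy matrix. -/
theorem six_vertex_RTT (γ : ℂ) (L : ℕ) (hL : 1 ≤ L) (μ : Fin L → ℂ) (l1 l2 : ℂ) :
    R12T γ (l1 - l2) * T1 γ μ l1 * T2 γ μ l2 =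
      T2 γ μ l2 * T1 γ μ l1 * R12T γ (l1 - l2) := by
  rw [T1_eq, T2_eq]
  exact train _ _ _ (fun i => local_YBE γ _ _ _ (by ring) i)
    (fun i j hij => local_comm γ _ _ i j hij) _ (List.nodup_finRange L)

end
end

section
/- The monodromy matrix entries A and B satisfy the exchange relation: for all λ₁, λ₂ ∈ ℂ, b(λ₂−λ₁) A(λ₁) B(λ₂) = a(λ₂−λ₁) B(λ₂) A(λ₁) − c(λ₂−λ₁) B(λ₁) A(λ₂) as operators on (ℂ²)^{⊗L}. -/
noncomputable section

/-- Local embedding of a single-site matrix at site `i`. -/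
def siteM {L : ℕ} (i : Fin L) (m : Matrix (Fin 2) (Fin 2) ℂ) :
    Matrix (Fin L → Fin 2) (Fin L → Fin 2) ℂ :=
  fun p q => m (p i) (q i) * (if ∀ k, k ≠ i → p k = q k then 1 else 0)

lemma siteM_mul_apply {L : ℕ} (i : Fin L) (m : Matrix (Fin 2) (Fin 2) ℂ)
    (N : Matrix (Fin L → Fin 2) (Fin L → Fin 2) ℂ) (p q : Fin L → Fin 2) :
    (siteM i m * N) p q = ∑ x : Fin 2, m (p i) x * N (Function.update p i x) q := by
  classical
  rw [Matrix.mul_apply]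
  symm
  have hinj : Function.Injective (fun x : Fin 2 => Function.update p i x) :=
    Function.update_injective p i
  have e := Finset.sum_image (s := Finset.univ) (g := fun x : Fin 2 => Function.update p i x)
    (f := fun r => siteM i m p r * N r q) (fun x _ y _ h => hinj h)
  refine Eq.trans ?_ (e.symm.trans ?_)
  rotate_left
  · apply Finset.sum_subset (Finset.subset_univ _)
    intro r _ hr
    have : ¬ ∀ k, k ≠ i → p k = r k := by
      intro h
      apply hr
      rw [Finset.mem_image]
      refine ⟨r i, Finset.mem_univ _, ?_⟩
      funext k
      by_cases hk : k = i
      · subst hk; simp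
      · simp [hk, h k hk]
    simp [siteM, this]
  · apply Finset.sum_congr rfl
    intro x _
    have : ∀ k, k ≠ i → p k = Function.update p i x k := by
      intro k hk; simp [hk]
    simp only [siteM, if_pos this]
    simp

lemma siteM_mul {L : ℕ} (i : Fin L) (m n : Matrix (Fin 2) (Fin 2) ℂ) :
    siteM i m * siteM i n = siteM i (m * n) := by
  ext p q
  rw [siteM_mul_apply]
  have : ∀ x, (∀ k, k ≠ i → Function.update p i x k = q k) ↔ (∀ k, k ≠ i → p k = q k) := by
    intro x
    refine forall_congr' fun k => forall_congr' fun hk => ?_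
    simp [hk]
  simp only [siteM, this, Matrix.mul_apply, Finset.sum_mul, Function.update_self, mul_assoc]

lemma siteM_mul_ne_apply {L : ℕ} (i j : Fin L) (hij : i ≠ j) (m n : Matrix (Fin 2) (Fin 2) ℂ)
    (p q : Fin L → Fin 2) :
    (siteM i m * siteM j n) p q = m (p i) (q i) * n (p j) (q j) *
      (if ∀ k, k ≠ i → k ≠ j → p k = q k then 1 else 0) := by
  rw [siteM_mul_apply, Finset.sum_eq_single (q i)]
  · have : (∀ k, k ≠ j → Function.update p i (q i) k = q k) ↔
        (∀ k, k ≠ i → k ≠ j → p k = q k) := by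
      constructor
      · intro h k hi hj
        simpa [hi] using h k hj
      · intro h k hj
        by_cases hi : k = i
        · subst hi; simp
        · simpa [hi] using h k hi hj
    simp only [siteM, this, Function.update_of_ne hij.symm, mul_assoc]
  · intro x _ hx
    have : ¬ (∀ k, k ≠ j → Function.update p i x k = q k) := by
      intro h
      exact hx (by simpa using h i hij)
    simp [siteM, this]
  · simp

lemma siteM_comm {L : ℕ} (i j : Fin L) (hij : i ≠ j) (m n : Matrix (Fin 2) (Fin 2) ℂ) :
    siteM i m * siteM j n = siteM j n * siteM i m := by
  ext p q
  rw [siteM_mul_ne_apply i j hij, siteM_mul_ne_apply j i hij.symm]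
  have : (∀ k, k ≠ i → k ≠ j → p k = q k) ↔ (∀ k, k ≠ j → k ≠ i → p k = q k) :=
    forall_congr' fun k => ⟨fun h a b => h b a, fun h a b => h b a⟩
  simp only [this]
  ring

/-- Blocks of the R-matrix. -/
def Rsub (γ lam : ℂ) (a c : Fin 2) : Matrix (Fin 2) (Fin 2) ℂ :=
  Matrix.of fun x y => Rmat γ lam (a, x) (c, y)

lemma Rsub_apply (γ lam : ℂ) (a c x y : Fin 2) :
    Rsub γ lam a c x y = Rmat γ lam (a, x) (c, y) := rfl

lemma siteM_apply {L : ℕ} (i : Fin L) (m : Matrix (Fin 2) (Fin 2) ℂ) (p q : Fin L → Fin 2) :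
    siteM i m p q = m (p i) (q i) * (if ∀ k, k ≠ i → p k = q k then 1 else 0) := rfl

/-- Blocks with respect to the auxiliary factor. -/
def blk {Q : Type} (T : Matrix (Fin 2 × Q) (Fin 2 × Q) ℂ) (a c : Fin 2) : Matrix Q Q ℂ :=
  fun p q => T (a, p) (c, q)

lemma blk_mul {Q : Type} [Fintype Q] (S T : Matrix (Fin 2 × Q) (Fin 2 × Q) ℂ) (a c : Fin 2) :
    blk (S * T) a c = blk S a 0 * blk T 0 c + blk S a 1 * blk T 1 c := by
  ext p q
  simp [blk, Matrix.mul_apply, Fintype.sum_prod_type]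

lemma blk_Rai (γ : ℂ) {L : ℕ} (lam : ℂ) (i : Fin L) (a c : Fin 2) :
    blk (Rai γ lam i) a c = siteM i (Rsub γ lam a c) := rfl

/-- The RTT relation, in components. -/
def RTT {M : Type} [Ring M] [Algebra ℂ M] (R : Matrix (Fin 2 × Fin 2) (Fin 2 × Fin 2) ℂ)
    (X Y : Fin 2 → Fin 2 → M) : Prop :=
  ∀ a b c d, ∑ e, ∑ f, R (a, b) (e, f) • (X e c * Y f d) =
    ∑ e, ∑ f, R (e, f) (c, d) • (Y b f * X a e)

lemma RTT_mul {M : Type} [Ring M] [Algebra ℂ M] (R : Matrix (Fin 2 × Fin 2) (Fin 2 × Fin 2) ℂ)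
    (X Y X' Y' : Fin 2 → Fin 2 → M) (h : RTT R X Y) (h' : RTT R X' Y')
    (hc : ∀ a b c d, X' a b * Y c d = Y c d * X' a b)
    (hc' : ∀ a b c d, Y' a b * X c d = X c d * Y' a b) :
    RTT R (fun a c => ∑ g, X a g * X' g c) (fun a c => ∑ g, Y a g * Y' g c) := by
  intro a b c d
  have e1 : ∀ e f, (∑ g, X e g * X' g c) * (∑ k, Y f k * Y' k d) =
      ∑ g, ∑ k, (X e g * Y f k) * (X' g c * Y' k d) := by
    intro e f
    rw [Finset.sum_mul_sum]
    refine Finset.sum_congr rfl fun g _ => Finset.sum_congr rfl fun k _ => ?_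
    rw [mul_assoc, ← mul_assoc (X' g c), hc]
    simp only [mul_assoc]
  have e2 : ∀ e f, (∑ k, Y b k * Y' k f) * (∑ g, X a g * X' g e) =
      ∑ g, ∑ k, (Y b k * X a g) * (Y' k f * X' g e) := by
    intro e f
    rw [Finset.sum_mul_sum, Finset.sum_comm]
    refine Finset.sum_congr rfl fun g _ => Finset.sum_congr rfl fun k _ => ?_
    rw [mul_assoc, ← mul_assoc (Y' k f), hc']
    simp only [mul_assoc]
  have m1 : ∀ g k, (∑ e, ∑ f, R (a, b) (e, f) • (X e g * Y f k)) * (X' g c * Y' k d) =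
      (∑ e, ∑ f, R (e, f) (g, k) • (Y b f * X a e)) * (X' g c * Y' k d) := by
    intro g k; rw [h a b g k]
  have m2 : ∀ e f, (Y b f * X a e) * (∑ g, ∑ k, R (e, f) (g, k) • (X' g c * Y' k d)) =
      (Y b f * X a e) * (∑ g, ∑ k, R (g, k) (c, d) • (Y' f k * X' e g)) := by
    intro e f; rw [h' e f c d]
  simp only [e1, e2]
  simp only [Fin.sum_univ_two, smul_add, add_mul, mul_add, smul_mul_assoc, mul_smul_comm] at m1 m2 ⊢
  have s1 := congrArg₂ (· + ·) (congrArg₂ (· + ·) (m1 0 0) (m1 0 1))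
    (congrArg₂ (· + ·) (m1 1 0) (m1 1 1))
  have s2 := congrArg₂ (· + ·) (congrArg₂ (· + ·) (m2 0 0) (m2 0 1))
    (congrArg₂ (· + ·) (m2 1 0) (m2 1 1))
  clear m1 m2 e1 e2 h h' hc hc'
  refine Eq.trans ?_ (s1.trans (Eq.trans ?_ (s2.trans ?_))) <;> abel

lemma YBE_s2 (γ x y : ℂ) (a b c d s t : Fin 2) :
    ∑ e, ∑ f, Rmat γ (x - y) (a, b) (e, f) *
      ∑ r, Rmat γ x (e, s) (c, r) * Rmat γ y (f, r) (d, t) =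
    ∑ e, ∑ f, Rmat γ (x - y) (e, f) (c, d) *
      ∑ r, Rmat γ y (b, s) (f, r) * Rmat γ x (a, r) (e, t) := by
  obtain ⟨u, rfl⟩ : ∃ u, x = y + u := ⟨x - y, by ring⟩
  rw [add_sub_cancel_left]
  have hg : Complex.exp γ ≠ 0 := Complex.exp_ne_zero _
  have hu : Complex.exp u ≠ 0 := Complex.exp_ne_zero _
  have hy : Complex.exp y ≠ 0 := Complex.exp_ne_zero _
  fin_cases a <;> fin_cases b <;> fin_cases c <;> fin_cases d <;> fin_cases s <;> fin_cases t <;>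
    simp [Rmat, Fin.sum_univ_two] <;>
    simp only [af, bf, cf, Complex.sinh, neg_add, Complex.exp_add, Complex.exp_neg] <;>
    field_simp <;> first | ring1 | (left; ring1) | (left; trivial) | (left; ring_nf)

lemma RTT_site (γ : ℂ) {L : ℕ} (i : Fin L) (x y : ℂ) :
    RTT (Rmat γ (x - y)) (blk (Rai γ x i)) (blk (Rai γ y i)) := by
  intro a b c d
  ext p q
  have := YBE_s2 γ x y a b c d (p i) (q i)
  simp only [blk_Rai, siteM_mul, Matrix.sum_apply, Matrix.smul_apply, smul_eq_mul]
  simp only [siteM_apply, Matrix.mul_apply, Rsub_apply]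
  simp only [← mul_assoc (Rmat _ _ _ _) (Finset.sum _ _) _, ← Finset.sum_mul]
  rw [this]

lemma RTT_list (γ : ℂ) {L : ℕ} (μ : Fin L → ℂ) (x y : ℂ) (l : List (Fin L)) (hl : l.Nodup) :
    RTT (Rmat γ (x - y)) (blk (l.map fun i => Rai γ (x - μ i) i).prod)
      (blk (l.map fun i => Rai γ (y - μ i) i).prod) ∧
    ∀ z j, j ∉ l → ∀ m a b, blk (l.map fun i => Rai γ (z - μ i) i).prod a b * siteM j m =
      siteM j m * blk (l.map fun i => Rai γ (z - μ i) i).prod a b := by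
  induction l with
  | nil =>
    have h1 : ∀ a b : Fin 2, blk (1 : Matrix (Fin 2 × (Fin L → Fin 2)) _ ℂ) a b =
        if a = b then 1 else 0 := by
      intro a b
      ext p q
      by_cases h : a = b <;> simp [blk, Matrix.one_apply, h]
    constructor
    · intro a b c d
      simp [h1]
    · intro z j _ m a b
      simp only [List.map_nil, List.prod_nil, h1]
      split_ifs <;> simp
  | cons i l ih =>
    rw [List.nodup_cons] at hl
    obtain ⟨ih1, ih2⟩ := ih hl.2
    have hb : ∀ z, blk ((i :: l).map fun i => Rai γ (z - μ i) i).prod = fun a c =>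
        ∑ g, blk (Rai γ (z - μ i) i) a g * blk (l.map fun i => Rai γ (z - μ i) i).prod g c := by
      intro z
      funext a c
      rw [List.map_cons, List.prod_cons, blk_mul, Fin.sum_univ_two]
    constructor
    · rw [hb, hb]
      apply RTT_mul
      · have := RTT_site γ i (x - μ i) (y - μ i)
        rwa [sub_sub_sub_cancel_right] at this
      · exact ih1
      · intro a b c d
        rw [blk_Rai]
        exact ih2 x i hl.1 _ _ _
      · intro a b c d
        rw [blk_Rai]
        exact ih2 y i hl.1 _ _ _
    · intro z j hj m a b
      rw [List.mem_cons, not_or] at hj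
      rw [hb]
      simp only [Finset.sum_mul, Finset.mul_sum]
      refine Finset.sum_congr rfl fun g _ => ?_
      rw [mul_assoc, ih2 z j hj.2, ← mul_assoc, blk_Rai, siteM_comm i j (Ne.symm hj.1), mul_assoc]

/-- Exchange relation between `A` and `B`:
`b(λ₂−λ₁) A(λ₁) B(λ₂) = a(λ₂−λ₁) B(λ₂) A(λ₁) − c(λ₂−λ₁) B(λ₁) A(λ₂)`. -/
theorem six_vertex_AB_exchange (γ : ℂ) (L : ℕ) (hL : 1 ≤ L) (μ : Fin L → ℂ)
    (l1 l2 : ℂ) :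
    bf (l2 - l1) • (Aop γ μ l1 * Bop γ μ l2) =
      af γ (l2 - l1) • (Bop γ μ l2 * Aop γ μ l1) -
        cf γ (l2 - l1) • (Bop γ μ l1 * Aop γ μ l2) := by
  have h := (RTT_list γ μ l2 l1 (List.finRange L) (List.nodup_finRange L)).1 0 0 1 0
  have hT : ∀ z, ((List.finRange L).map fun i => Rai γ (z - μ i) i).prod = Tmat γ μ z := by
    intro z
    rw [Tmat, List.ofFn_eq_map]
  simp only [hT] at h
  have hA : ∀ z, blk (Tmat γ μ z) 0 0 = Aop γ μ z := fun _ => rfl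
  have hB : ∀ z, blk (Tmat γ μ z) 0 1 = Bop γ μ z := fun _ => rfl
  simp [Fin.sum_univ_two, Rmat, hA, hB] at h
  rw [h]
  abel

end
end

section
/- The elliptic dynamical R-matrix satisfies the dynamical Yang–Baxter equation: for all λ₁, λ₂, λ₃, θ ∈ ℂ such that all theta-function denominators occurring are nonzero, R₁₂(λ₁−λ₂, θ−γh₃) R₁₃(λ₁−λ₃, θ) R₂₃(λ₂−λ₃, θ−γh₁) = R₂₃(λ₂−λ₃, θ) R₁₃(λ₁−λ₃, θ−γh₂) R₁₂(λ₁−λ₂, θ) as linear operators on ℂ² ⊗ ℂ² ⊗ ℂ². -/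
noncomputable section

/-- `f(λ) = Θ₁(iλ, τ)/2`, where
`Θ₁(z, τ) = 2 ∑_{n=0}^{∞} (−1)ⁿ e^{iπτ(n+1/2)²} sin((2n+1)z)` is the Jacobi
theta function `θ₁`. -/
def thetaf (τ lam : ℂ) : ℂ :=
  ∑' n : ℕ,
    (-1) ^ n * Complex.exp ((Real.pi : ℂ) * Complex.I * τ * ((n : ℂ) + 1 / 2) ^ 2) *
      Complex.sin ((2 * (n : ℂ) + 1) * (Complex.I * lam))

/-- The elliptic dynamical R-matrix `R(λ, θ)` on `ℂ² ⊗ ℂ²`, in the ordered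
basis `(e₁⊗e₁, e₁⊗e₂, e₂⊗e₁, e₂⊗e₂)` encoded by pairs in `Fin 2 × Fin 2`. -/
def Rdyn (τ γ lam θ : ℂ) : Matrix (Fin 2 × Fin 2) (Fin 2 × Fin 2) ℂ :=
  fun p q =>
    if p = q then
      (if p.1 = p.2 then thetaf τ (lam + γ)
       else if p.1 = 0 then thetaf τ lam * thetaf τ (θ - γ) / thetaf τ θ
       else thetaf τ lam * thetaf τ (θ + γ) / thetaf τ θ)
    else if p.1 = q.2 ∧ p.2 = q.1 then
      (if p.1 = 0 then thetaf τ γ * thetaf τ (θ - lam) / thetaf τ θ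
       else thetaf τ γ * thetaf τ (θ + lam) / thetaf τ θ)
    else 0

/-- The `h`-eigenvalue of the basis vector `e_s` of `ℂ²`: `ε₁ = 1, ε₂ = −1`. -/
def eps (s : Fin 2) : ℂ := if s = 0 then 1 else -1

/-- `R₁₂(λ, θ)` on `ℂ² ⊗ ℂ² ⊗ ℂ²`. -/
def R12dyn (τ γ lam θ : ℂ) :
    Matrix (Fin 2 × Fin 2 × Fin 2) (Fin 2 × Fin 2 × Fin 2) ℂ :=
  fun p q => Rdyn τ γ lam θ (p.1, p.2.1) (q.1, q.2.1) * (if p.2.2 = q.2.2 then 1 else 0)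

/-- `R₁₂(λ, θ − γ h₃)` on `ℂ² ⊗ ℂ² ⊗ ℂ²`: the dynamical shift is governed by
the `h`-eigenvalue of the third factor. -/
def R12dynH3 (τ γ lam θ : ℂ) :
    Matrix (Fin 2 × Fin 2 × Fin 2) (Fin 2 × Fin 2 × Fin 2) ℂ :=
  fun p q =>
    Rdyn τ γ lam (θ - γ * eps q.2.2) (p.1, p.2.1) (q.1, q.2.1) *
      (if p.2.2 = q.2.2 then 1 else 0)

/-- `R₁₃(λ, θ)` on `ℂ² ⊗ ℂ² ⊗ ℂ²`. -/
def R13dyn (τ γ lam θ : ℂ) :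
    Matrix (Fin 2 × Fin 2 × Fin 2) (Fin 2 × Fin 2 × Fin 2) ℂ :=
  fun p q => Rdyn τ γ lam θ (p.1, p.2.2) (q.1, q.2.2) * (if p.2.1 = q.2.1 then 1 else 0)

/-- `R₁₃(λ, θ − γ h₂)` on `ℂ² ⊗ ℂ² ⊗ ℂ²`. -/
def R13dynH2 (τ γ lam θ : ℂ) :
    Matrix (Fin 2 × Fin 2 × Fin 2) (Fin 2 × Fin 2 × Fin 2) ℂ :=
  fun p q =>
    Rdyn τ γ lam (θ - γ * eps q.2.1) (p.1, p.2.2) (q.1, q.2.2) *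
      (if p.2.1 = q.2.1 then 1 else 0)

/-- `R₂₃(λ, θ)` on `ℂ² ⊗ ℂ² ⊗ ℂ²`. -/
def R23dyn (τ γ lam θ : ℂ) :
    Matrix (Fin 2 × Fin 2 × Fin 2) (Fin 2 × Fin 2 × Fin 2) ℂ :=
  fun p q => Rdyn τ γ lam θ (p.2.1, p.2.2) (q.2.1, q.2.2) * (if p.1 = q.1 then 1 else 0)

/-- `R₂₃(λ, θ − γ h₁)` on `ℂ² ⊗ ℂ² ⊗ ℂ²`. -/
def R23dynH1 (τ γ lam θ : ℂ) :
    Matrix (Fin 2 × Fin 2 × Fin 2) (Fin 2 × Fin 2 × Fin 2) ℂ :=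
  fun p q =>
    Rdyn τ γ lam (θ - γ * eps q.1) (p.2.1, p.2.2) (q.2.1, q.2.2) *
      (if p.1 = q.1 then 1 else 0)

/-- Exponential terms of the two-sided series for `thetaf`. -/
def Gterm (τ : ℂ) (x : ℂ) (n : ℤ) : ℂ :=
  Complex.exp ((Real.pi : ℂ) * Complex.I * n + (Real.pi : ℂ) * Complex.I * τ * ((n : ℂ) + 1 / 2) ^ 2
    - (2 * (n : ℂ) + 1) * x)

def Eterm (τ : ℂ) (x : ℂ) (n : ℤ) : ℂ :=
  Complex.exp (2 * (Real.pi : ℂ) * Complex.I * τ * (n : ℂ) ^ 2 - 4 * (n : ℂ) * x)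

def Oterm (τ : ℂ) (x : ℂ) (n : ℤ) : ℂ :=
  Complex.exp (2 * (Real.pi : ℂ) * Complex.I * τ * ((n : ℂ) + 1 / 2) ^ 2 - 2 * (2 * (n : ℂ) + 1) * x)

lemma summable_Gterm {τ : ℂ} (hτ : 0 < τ.im) (x : ℂ) : Summable (Gterm τ x) := by
  have h := (summable_jacobiTheta₂_term_iff
    (1 / 2 + τ / 2 - x / ((Real.pi : ℂ) * Complex.I)) τ).2 hτ
  have h2 := h.mul_left (Complex.exp ((Real.pi : ℂ) * Complex.I * τ / 4 - x))
  refine h2.congr (fun n => ?_)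
  have hpi : (Real.pi : ℂ) ≠ 0 := by exact_mod_cast Real.pi_ne_zero
  have hI := Complex.I_ne_zero
  rw [jacobiTheta₂_term, ← Complex.exp_add, Gterm]
  congr 1
  field_simp
  ring

lemma summable_Eterm {τ : ℂ} (hτ : 0 < τ.im) (x : ℂ) : Summable (Eterm τ x) := by
  have hτ2 : 0 < (2 * τ).im := by simpa using hτ
  have h := (summable_jacobiTheta₂_term_iff
    (- 2 * x / ((Real.pi : ℂ) * Complex.I)) (2 * τ)).2 hτ2
  refine h.congr (fun n => ?_)
  have hpi : (Real.pi : ℂ) ≠ 0 := by exact_mod_cast Real.pi_ne_zero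
  have hI := Complex.I_ne_zero
  rw [jacobiTheta₂_term, Eterm]
  congr 1
  field_simp
  ring

lemma summable_Oterm {τ : ℂ} (hτ : 0 < τ.im) (x : ℂ) : Summable (Oterm τ x) := by
  have hτ2 : 0 < (2 * τ).im := by simpa using hτ
  have h := (summable_jacobiTheta₂_term_iff
    (τ - 2 * x / ((Real.pi : ℂ) * Complex.I)) (2 * τ)).2 hτ2
  have h2 := h.mul_left (Complex.exp ((Real.pi : ℂ) * Complex.I * τ / 2 - 2 * x))
  refine h2.congr (fun n => ?_)
  have hpi : (Real.pi : ℂ) ≠ 0 := by exact_mod_cast Real.pi_ne_zero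
  have hI := Complex.I_ne_zero
  rw [jacobiTheta₂_term, ← Complex.exp_add, Oterm]
  congr 1
  field_simp
  ring

lemma exp_pi_nat (n : ℕ) : Complex.exp ((Real.pi : ℂ) * Complex.I * n) = (-1) ^ n := by
  rw [mul_comm, Complex.exp_nat_mul, Complex.exp_pi_mul_I]

lemma thetaf_eq {τ : ℂ} (hτ : 0 < τ.im) (x : ℂ) :
    thetaf τ x = (- Complex.I / 2) * ∑' n : ℤ, Gterm τ x n := by
  have h := ((summable_Gterm hτ x).hasSum.nat_add_neg_add_one).mul_left (- Complex.I / 2)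
  rw [← h.tsum_eq, thetaf]
  refine tsum_congr (fun n => ?_)
  have e1 : Gterm τ x (n : ℤ) = (-1) ^ n *
      Complex.exp ((Real.pi : ℂ) * Complex.I * τ * ((n : ℂ) + 1 / 2) ^ 2) *
      Complex.exp (-((2 * (n : ℂ) + 1) * x)) := by
    rw [← exp_pi_nat, ← Complex.exp_add, ← Complex.exp_add, Gterm]
    congr 1
  have e2 : Gterm τ x (-((n : ℤ) + 1)) = - ((-1) ^ n *
      Complex.exp ((Real.pi : ℂ) * Complex.I * τ * ((n : ℂ) + 1 / 2) ^ 2) *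
      Complex.exp ((2 * (n : ℂ) + 1) * x)) := by
    have e3 : ((-1 : ℂ)) ^ n = - Complex.exp (- ((Real.pi : ℂ) * Complex.I * ((n + 1 : ℕ) : ℂ))) := by
      rw [Complex.exp_neg, exp_pi_nat, pow_succ, mul_neg_one, inv_neg, neg_neg, ← inv_pow]
      norm_num
    rw [e3, neg_mul, neg_mul, neg_neg, ← Complex.exp_add, ← Complex.exp_add, Gterm]
    congr 1
    push_cast
    ring
  rw [e1, e2, Complex.sin]
  rw [show -((2 * (n : ℂ) + 1) * (Complex.I * x)) * Complex.I = (2 * (n : ℂ) + 1) * x by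
    linear_combination (-(2 * (n : ℂ) + 1) * x) * Complex.I_mul_I]
  rw [show ((2 * (n : ℂ) + 1) * (Complex.I * x)) * Complex.I = -((2 * (n : ℂ) + 1) * x) by
    linear_combination ((2 * (n : ℂ) + 1) * x) * Complex.I_mul_I]
  ring

/-- Splitting pairs of integers by the parity of their sum. -/
def paritySplit : (ℤ × ℤ) ⊕ (ℤ × ℤ) ≃ ℤ × ℤ where
  toFun := Sum.elim (fun p => (p.1 + p.2, p.1 - p.2)) (fun p => (p.1 + p.2, p.1 - p.2 - 1))
  invFun q := if (q.1 + q.2) % 2 = 0 then Sum.inl ((q.1 + q.2) / 2, (q.1 - q.2) / 2)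
    else Sum.inr ((q.1 + q.2 + 1) / 2, (q.1 - q.2 - 1) / 2)
  left_inv := by
    rintro (⟨a, b⟩ | ⟨a, b⟩)
    · change (if (a + b + (a - b)) % 2 = 0 then
        Sum.inl ((a + b + (a - b)) / 2, (a + b - (a - b)) / 2)
        else Sum.inr ((a + b + (a - b) + 1) / 2, (a + b - (a - b) - 1) / 2)) = Sum.inl (a, b)
      rw [if_pos (by omega)]
      congr 2 <;> omega
    · change (if (a + b + (a - b - 1)) % 2 = 0 then
        Sum.inl ((a + b + (a - b - 1)) / 2, (a + b - (a - b - 1)) / 2)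
        else Sum.inr ((a + b + (a - b - 1) + 1) / 2, (a + b - (a - b - 1) - 1) / 2)) = Sum.inr (a, b)
      rw [if_neg (by omega)]
      congr 2 <;> omega
  right_inv := by
    rintro ⟨a, b⟩
    by_cases h : (a + b) % 2 = 0
    · simp only [h, if_true, Sum.elim_inl, Prod.mk.injEq]
      constructor <;> omega
    · simp only [h, if_false, Sum.elim_inr, Prod.mk.injEq]
      constructor <;> omega

lemma Gterm_even (τ x y : ℂ) (a b : ℤ) :
    Gterm τ (x + y) (a + b) * Gterm τ (x - y) (a - b) = Oterm τ x a * Eterm τ y b := by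
  simp only [Gterm, Oterm, Eterm, ← Complex.exp_add]
  rw [Complex.exp_eq_exp_iff_exists_int]
  refine ⟨a, ?_⟩
  push_cast
  ring

lemma Gterm_odd (τ x y : ℂ) (a b : ℤ) :
    Gterm τ (x + y) (a + b) * Gterm τ (x - y) (a - b - 1) = - (Eterm τ x a * Oterm τ y b) := by
  rw [← neg_one_mul, ← Complex.exp_pi_mul_I]
  simp only [Gterm, Oterm, Eterm, ← Complex.exp_add]
  rw [Complex.exp_eq_exp_iff_exists_int]
  refine ⟨a - 1, ?_⟩
  push_cast
  ring

lemma tsum_Gterm_mul {τ : ℂ} (hτ : 0 < τ.im) (x y : ℂ) :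
    (∑' n : ℤ, Gterm τ (x + y) n) * (∑' n : ℤ, Gterm τ (x - y) n) =
      (∑' n : ℤ, Oterm τ x n) * (∑' n : ℤ, Eterm τ y n) -
      (∑' n : ℤ, Eterm τ x n) * (∑' n : ℤ, Oterm τ y n) := by
  have hG1 := (summable_Gterm hτ (x + y)).norm
  have hG2 := (summable_Gterm hτ (x - y)).norm
  have hOx := (summable_Oterm hτ x).norm
  have hOy := (summable_Oterm hτ y).norm
  have hEx := (summable_Eterm hτ x).norm
  have hEy := (summable_Eterm hτ y).norm
  rw [tsum_mul_tsum_of_summable_norm hG1 hG2, tsum_mul_tsum_of_summable_norm hOx hEy,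
    tsum_mul_tsum_of_summable_norm hEx hOy, ← paritySplit.tsum_eq]
  have s1 := (summable_mul_of_summable_norm hOx hEy).hasSum
  have s2 := (summable_mul_of_summable_norm hEx hOy).hasSum.neg
  rw [sub_eq_add_neg (∑' z : ℤ × ℤ, Oterm τ x z.1 * Eterm τ y z.2)]
  refine HasSum.tsum_eq (HasSum.sum ?_ ?_)
  · have e : (fun p : ℤ × ℤ => Gterm τ (x + y) (p.1 + p.2) * Gterm τ (x - y) (p.1 - p.2)) =
        fun p : ℤ × ℤ => Oterm τ x p.1 * Eterm τ y p.2 :=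
      funext (fun p : ℤ × ℤ => Gterm_even τ x y p.1 p.2)
    have s3 : HasSum (fun p : ℤ × ℤ => Gterm τ (x + y) (p.1 + p.2) * Gterm τ (x - y) (p.1 - p.2))
        (∑' z : ℤ × ℤ, Oterm τ x z.1 * Eterm τ y z.2) := by
      rw [e]
      exact s1
    exact s3
  · rw [← show _ = _ from funext (fun p : ℤ × ℤ => Gterm_odd τ x y p.1 p.2)] at s2
    exact s2

lemma thetaf_mul {τ : ℂ} (hτ : 0 < τ.im) (x y : ℂ) :
    thetaf τ (x + y) * thetaf τ (x - y) =
      (- 1 / 4) * ((∑' n : ℤ, Oterm τ x n) * (∑' n : ℤ, Eterm τ y n) -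
      (∑' n : ℤ, Eterm τ x n) * (∑' n : ℤ, Oterm τ y n)) := by
  rw [← tsum_Gterm_mul hτ, thetaf_eq hτ, thetaf_eq hτ]
  linear_combination (1 / 4 * (∑' n : ℤ, Gterm τ (x + y) n) * (∑' n : ℤ, Gterm τ (x - y) n)) *
    Complex.I_mul_I

/-- The Weierstrass three-term identity. -/
lemma thetaf_three_term {τ : ℂ} (hτ : 0 < τ.im) (x y z w : ℂ) :
    thetaf τ (x + y) * thetaf τ (x - y) * (thetaf τ (z + w) * thetaf τ (z - w))
      - thetaf τ (x + z) * thetaf τ (x - z) * (thetaf τ (y + w) * thetaf τ (y - w))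
      + thetaf τ (x + w) * thetaf τ (x - w) * (thetaf τ (y + z) * thetaf τ (y - z)) = 0 := by
  simp only [thetaf_mul hτ]
  ring

lemma thetaf_neg (τ x : ℂ) : thetaf τ (-x) = - thetaf τ x := by
  rw [thetaf, thetaf, ← tsum_neg]
  refine tsum_congr (fun n => ?_)
  rw [mul_neg, mul_neg, Complex.sin_neg, mul_neg]


lemma Rdyn_expand (τ γ l t : ℂ) (a b c d : Fin 2) : Rdyn τ γ l t (a, b) (c, d) =
    if a = c ∧ b = d then
      (if a = b then thetaf τ (l + γ)
       else if a = 0 then thetaf τ l * thetaf τ (t - γ) / thetaf τ t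
       else thetaf τ l * thetaf τ (t + γ) / thetaf τ t)
    else if a = d ∧ b = c then
      (if a = 0 then thetaf τ γ * thetaf τ (t - l) / thetaf τ t
       else thetaf τ γ * thetaf τ (t + l) / thetaf τ t)
    else 0 := by
  simp only [Rdyn, Prod.mk.injEq]

set_option maxHeartbeats 8000000 in
/-- The elliptic dynamical R-matrix satisfies the dynamical Yang–Baxter
equation. -/
theorem dynamical_yang_baxter (τ γ : ℂ) (hτ : 0 < τ.im) (l1 l2 l3 θ : ℂ)
    (hθ : thetaf τ θ ≠ 0) (hθm : thetaf τ (θ - γ) ≠ 0)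
    (hθp : thetaf τ (θ + γ) ≠ 0) :
    R12dynH3 τ γ (l1 - l2) θ * R13dyn τ γ (l1 - l3) θ * R23dynH1 τ γ (l2 - l3) θ =
      R23dyn τ γ (l2 - l3) θ * R13dynH2 τ γ (l1 - l3) θ * R12dyn τ γ (l1 - l2) θ := by
  have hodd := thetaf_neg τ
  have hW := fun x y z w => thetaf_three_term hτ x y z w
  have e13 : l1 - l3 = (l1 - l2) + (l2 - l3) := by ring
  rw [e13]
  generalize l1 - l2 = u
  generalize l2 - l3 = v
  have hRaw := Rdyn_expand τ γ
  have e0 : eps 0 = 1 := by simp [eps]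
  have e1 : eps 1 = -1 := by simp [eps]
  generalize thetaf τ = f at *
  have fe : ∀ {a b : ℂ}, a = b → f a = f b := fun h => by rw [h]
  have fo : ∀ {a b : ℂ}, a = -b → f a = - f b := fun h => by rw [h, hodd]
  have W3 : ∀ (x y z w : ℂ) {A1 A2 A3 A4 B1 B2 B3 B4 C1 C2 C3 C4 : ℂ},
      f (x + y) = A1 → f (x - y) = A2 → f (z + w) = A3 → f (z - w) = A4 →
      f (x + z) = B1 → f (x - z) = B2 → f (y + w) = B3 → f (y - w) = B4 →
      f (x + w) = C1 → f (x - w) = C2 → f (y + z) = C3 → f (y - z) = C4 →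
      A1 * A2 * (A3 * A4) - B1 * B2 * (B3 * B4) + C1 * C2 * (C3 * C4) = 0 := by
    intro x y z w A1 A2 A3 A4 B1 B2 B3 B4 C1 C2 C3 C4 h1 h2 h3 h4 h5 h6 h7 h8 h9 h10 h11 h12
    rw [← h1, ← h2, ← h3, ← h4, ← h5, ← h6, ← h7, ← h8, ← h9, ← h10, ← h11, ← h12]
    exact hW x y z w
  have T001010 : f (θ - v - γ) * f (u + γ) * f (u + v) * f θ - f (θ - u - v - γ) * f γ * f v * f (θ + u) - f (θ - v) * f (θ - γ) * f u * f (u + v + γ) = 0 := by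
    have h := W3 ((θ + u - v) / 2) ((θ - u - v - 2 * γ) / 2) ((θ + u + v) / 2) ((-θ + u + v) / 2)
      (fe (b := θ - v - γ) (by ring))
      (fe (b := u + γ) (by ring))
      (fe (b := u + v) (by ring))
      (fe (b := θ) (by ring))
      (fe (b := θ + u) (by ring))
      (fo (b := v) (by ring))
      (fo (b := γ) (by ring))
      (fe (b := θ - u - v - γ) (by ring))
      (fe (b := u) (by ring))
      (fe (b := θ - v) (by ring))
      (fe (b := θ - γ) (by ring))
      (fo (b := u + v + γ) (by ring))
    linear_combination (1 : ℂ) * h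
  have T001100 : f (θ - u - v) * f (v + γ) * f (u + γ) * f θ - f (θ - u - v - γ) * f (θ + γ) * f v * f u - f (θ - u) * f (θ - v) * f γ * f (u + v + γ) = 0 := by
    have h := W3 ((θ - u + γ) / 2) ((θ - u - 2 * v - γ) / 2) ((θ + u + γ) / 2) ((-θ + u + γ) / 2)
      (fe (b := θ - u - v) (by ring))
      (fe (b := v + γ) (by ring))
      (fe (b := u + γ) (by ring))
      (fe (b := θ) (by ring))
      (fe (b := θ + γ) (by ring))
      (fo (b := u) (by ring))
      (fo (b := v) (by ring))
      (fe (b := θ - u - v - γ) (by ring))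
      (fe (b := γ) (by ring))
      (fe (b := θ - u) (by ring))
      (fe (b := θ - v) (by ring))
      (fo (b := u + v + γ) (by ring))
    linear_combination (1 : ℂ) * h
  have T010001 : f (θ + v - γ) * f u * f (u + v + γ) * f θ + f (θ - u - γ) * f γ * f v * f (θ + u + v) - f (θ + v) * f (u + γ) * f (u + v) * f (θ - γ) = 0 := by
    have h := W3 ((θ + u + v - γ) / 2) ((θ - u + v - γ) / 2) ((θ + u + v + γ) / 2) ((-θ + u + v + γ) / 2)
      (fe (b := θ + v - γ) (by ring))
      (fe (b := u) (by ring))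
      (fe (b := u + v + γ) (by ring))
      (fe (b := θ) (by ring))
      (fe (b := θ + u + v) (by ring))
      (fo (b := γ) (by ring))
      (fe (b := v) (by ring))
      (fe (b := θ - u - γ) (by ring))
      (fe (b := u + v) (by ring))
      (fe (b := θ - γ) (by ring))
      (fe (b := θ + v) (by ring))
      (fo (b := u + γ) (by ring))
    linear_combination (1 : ℂ) * h
  have T010010a : f γ * f γ * f γ * f (2 * θ - γ) + f (θ - 2 * γ) * f θ * f θ * f θ - f (θ - γ) * f (θ - γ) * f (θ - γ) * f (θ + γ) = 0 := by
    have h := W3 (γ) (0) (θ) (-θ + γ)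
      (fe (b := γ) (by ring))
      (fe (b := γ) (by ring))
      (fe (b := γ) (by ring))
      (fe (b := 2 * θ - γ) (by ring))
      (fe (b := θ + γ) (by ring))
      (fo (b := θ - γ) (by ring))
      (fo (b := θ - γ) (by ring))
      (fe (b := θ - γ) (by ring))
      (fo (b := θ - 2 * γ) (by ring))
      (fe (b := θ) (by ring))
      (fe (b := θ) (by ring))
      (fo (b := θ) (by ring))
    linear_combination (1 : ℂ) * h
  have T010010b : -(f u * f v * f (u + v + γ) * f (2 * θ - γ)) + f (θ - u - γ) * f (θ - v - γ) * f (θ + u + v) * f θ - f (θ - u - v - γ) * f (θ + v) * f (θ + u) * f (θ - γ) = 0 := by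
    have h := W3 ((u + v) / 2) ((u - v) / 2) ((2 * θ + u + v) / 2) ((-2 * θ + u + v + 2 * γ) / 2)
      (fe (b := u) (by ring))
      (fe (b := v) (by ring))
      (fe (b := u + v + γ) (by ring))
      (fe (b := 2 * θ - γ) (by ring))
      (fe (b := θ + u + v) (by ring))
      (fo (b := θ) (by ring))
      (fo (b := θ - u - γ) (by ring))
      (fe (b := θ - v - γ) (by ring))
      (fo (b := θ - u - v - γ) (by ring))
      (fe (b := θ - γ) (by ring))
      (fe (b := θ + u) (by ring))
      (fo (b := θ + v) (by ring))
    linear_combination (-1 : ℂ) * h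
  have T010100 : f (θ - u - γ) * f (v + γ) * f (u + v) * f θ - f (θ - u - v - γ) * f γ * f (θ + v) * f u - f (θ - u) * f v * f (u + v + γ) * f (θ - γ) = 0 := by
    have h := W3 ((θ - u + v) / 2) ((θ - u - v - 2 * γ) / 2) ((θ + u + v) / 2) ((-θ + u + v) / 2)
      (fe (b := θ - u - γ) (by ring))
      (fe (b := v + γ) (by ring))
      (fe (b := u + v) (by ring))
      (fe (b := θ) (by ring))
      (fe (b := θ + v) (by ring))
      (fo (b := u) (by ring))
      (fo (b := γ) (by ring))
      (fe (b := θ - u - v - γ) (by ring))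
      (fe (b := v) (by ring))
      (fe (b := θ - u) (by ring))
      (fe (b := θ - γ) (by ring))
      (fo (b := u + v + γ) (by ring))
    linear_combination (1 : ℂ) * h
  have T011101 : f (θ - u - v) * f γ * f (θ + v + γ) * f u + f (θ - u + γ) * f θ * f v * f (u + v + γ) - f (θ - u) * f (v + γ) * f (u + v) * f (θ + γ) = 0 := by
    have h := W3 ((θ - u - v + γ) / 2) ((θ - u - v - γ) / 2) ((θ + u + v + γ) / 2) ((θ - u + v + γ) / 2)
      (fe (b := θ - u - v) (by ring))
      (fe (b := γ) (by ring))
      (fe (b := θ + v + γ) (by ring))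
      (fe (b := u) (by ring))
      (fe (b := θ + γ) (by ring))
      (fo (b := u + v) (by ring))
      (fe (b := θ - u) (by ring))
      (fo (b := v + γ) (by ring))
      (fe (b := θ - u + γ) (by ring))
      (fo (b := v) (by ring))
      (fe (b := θ) (by ring))
      (fo (b := u + v + γ) (by ring))
    linear_combination (1 : ℂ) * h
  have T011110 : f (θ - u - v) * f (θ + 2 * γ) * f v * f u + f (θ - u + γ) * f (θ - v + γ) * f γ * f (u + v + γ) - f (θ - u - v + γ) * f (v + γ) * f (u + γ) * f (θ + γ) = 0 := by
    have h := W3 ((2 * θ - u - v + 2 * γ) / 2) ((-u - v - 2 * γ) / 2) ((u + v) / 2) ((-u + v) / 2)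
      (fe (b := θ - u - v) (by ring))
      (fe (b := θ + 2 * γ) (by ring))
      (fe (b := v) (by ring))
      (fe (b := u) (by ring))
      (fe (b := θ + γ) (by ring))
      (fe (b := θ - u - v + γ) (by ring))
      (fo (b := u + γ) (by ring))
      (fo (b := v + γ) (by ring))
      (fe (b := θ - u + γ) (by ring))
      (fe (b := θ - v + γ) (by ring))
      (fo (b := γ) (by ring))
      (fo (b := u + v + γ) (by ring))
    linear_combination (1 : ℂ) * h
  have T100001 : f γ * f (θ + v - γ) * f (θ + u - γ) * f (u + v + γ) + f (θ - 2 * γ) * f v * f u * f (θ + u + v) - f (v + γ) * f (u + γ) * f (θ + u + v - γ) * f (θ - γ) = 0 := by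
    have h := W3 ((θ + v) / 2) ((-θ - v + 2 * γ) / 2) ((θ + 2 * u + v) / 2) ((θ - v - 2 * γ) / 2)
      (fe (b := γ) (by ring))
      (fe (b := θ + v - γ) (by ring))
      (fe (b := θ + u - γ) (by ring))
      (fe (b := u + v + γ) (by ring))
      (fe (b := θ + u + v) (by ring))
      (fo (b := u) (by ring))
      (fo (b := v) (by ring))
      (fo (b := θ - 2 * γ) (by ring))
      (fe (b := θ - γ) (by ring))
      (fe (b := v + γ) (by ring))
      (fe (b := u + γ) (by ring))
      (fo (b := θ + u + v - γ) (by ring))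
    linear_combination (1 : ℂ) * h
  have T100010 : f θ * f v * f (θ + u - γ) * f (u + v + γ) + f (θ - v - γ) * f γ * f u * f (θ + u + v) - f (v + γ) * f (θ + u) * f (u + v) * f (θ - γ) = 0 := by
    have h := W3 ((θ + v) / 2) ((θ - v) / 2) ((θ + 2 * u + v) / 2) ((θ - v - 2 * γ) / 2)
      (fe (b := θ) (by ring))
      (fe (b := v) (by ring))
      (fe (b := θ + u - γ) (by ring))
      (fe (b := u + v + γ) (by ring))
      (fe (b := θ + u + v) (by ring))
      (fo (b := u) (by ring))
      (fe (b := θ - v - γ) (by ring))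
      (fe (b := γ) (by ring))
      (fe (b := θ - γ) (by ring))
      (fe (b := v + γ) (by ring))
      (fe (b := θ + u) (by ring))
      (fo (b := u + v) (by ring))
    linear_combination (1 : ℂ) * h
  have T101011 : f (v + γ) * f (θ + u + γ) * f (u + v) * f θ - f v * f (θ + u) * f (u + v + γ) * f (θ + γ) - f (θ - v) * f γ * f u * f (θ + u + v + γ) = 0 := by
    have h := W3 ((θ + u + v + 2 * γ) / 2) ((-θ - u + v) / 2) ((θ + u + v) / 2) ((-θ + u + v) / 2)
      (fe (b := v + γ) (by ring))
      (fe (b := θ + u + γ) (by ring))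
      (fe (b := u + v) (by ring))
      (fe (b := θ) (by ring))
      (fe (b := θ + u + v + γ) (by ring))
      (fe (b := γ) (by ring))
      (fo (b := θ - v) (by ring))
      (fo (b := u) (by ring))
      (fe (b := u + v + γ) (by ring))
      (fe (b := θ + γ) (by ring))
      (fe (b := v) (by ring))
      (fo (b := θ + u) (by ring))
    linear_combination (1 : ℂ) * h
  have T101101a : -(f γ * f γ * f γ * f (2 * θ + γ)) + f θ * f θ * f θ * f (θ + 2 * γ) - f (θ - γ) * f (θ + γ) * f (θ + γ) * f (θ + γ) = 0 := by
    have h := W3 (γ) (0) (θ + γ) (-θ)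
      (fe (b := γ) (by ring))
      (fe (b := γ) (by ring))
      (fe (b := γ) (by ring))
      (fe (b := 2 * θ + γ) (by ring))
      (fe (b := θ + 2 * γ) (by ring))
      (fo (b := θ) (by ring))
      (fo (b := θ) (by ring))
      (fe (b := θ) (by ring))
      (fo (b := θ - γ) (by ring))
      (fe (b := θ + γ) (by ring))
      (fe (b := θ + γ) (by ring))
      (fo (b := θ + γ) (by ring))
    linear_combination (-1 : ℂ) * h
  have T101101b : f u * f v * f (u + v + γ) * f (2 * θ + γ) + f (θ - u - v) * f (θ + v + γ) * f (θ + u + γ) * f θ - f (θ - u) * f (θ - v) * f (θ + u + v + γ) * f (θ + γ) = 0 := by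
    have h := W3 ((u + v) / 2) ((u - v) / 2) ((2 * θ + u + v + 2 * γ) / 2) ((-2 * θ + u + v) / 2)
      (fe (b := u) (by ring))
      (fe (b := v) (by ring))
      (fe (b := u + v + γ) (by ring))
      (fe (b := 2 * θ + γ) (by ring))
      (fe (b := θ + u + v + γ) (by ring))
      (fo (b := θ + γ) (by ring))
      (fo (b := θ - u) (by ring))
      (fe (b := θ - v) (by ring))
      (fo (b := θ - u - v) (by ring))
      (fe (b := θ) (by ring))
      (fe (b := θ + u + γ) (by ring))
      (fo (b := θ + v + γ) (by ring))
    linear_combination (1 : ℂ) * h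
  have T101110 : f (θ - u - v) * f γ * f v * f (θ + u + γ) + f (θ - v + γ) * f u * f (u + v + γ) * f θ - f (θ - v) * f (u + γ) * f (u + v) * f (θ + γ) = 0 := by
    have h := W3 ((θ - u - v + γ) / 2) ((θ - u - v - γ) / 2) ((θ + u + v + γ) / 2) ((-θ - u + v - γ) / 2)
      (fe (b := θ - u - v) (by ring))
      (fe (b := γ) (by ring))
      (fe (b := v) (by ring))
      (fe (b := θ + u + γ) (by ring))
      (fe (b := θ + γ) (by ring))
      (fo (b := u + v) (by ring))
      (fo (b := u + γ) (by ring))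
      (fe (b := θ - v) (by ring))
      (fo (b := u) (by ring))
      (fe (b := θ - v + γ) (by ring))
      (fe (b := θ) (by ring))
      (fo (b := u + v + γ) (by ring))
    linear_combination (1 : ℂ) * h
  have T110011 : f (v + γ) * f (u + γ) * f (θ + u + v) * f θ - f γ * f (θ + v) * f (θ + u) * f (u + v + γ) - f (θ - γ) * f v * f u * f (θ + u + v + γ) = 0 := by
    have h := W3 ((u + v + 2 * γ) / 2) ((-u + v) / 2) ((2 * θ + u + v) / 2) ((u + v) / 2)
      (fe (b := v + γ) (by ring))
      (fe (b := u + γ) (by ring))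
      (fe (b := θ + u + v) (by ring))
      (fe (b := θ) (by ring))
      (fe (b := θ + u + v + γ) (by ring))
      (fo (b := θ - γ) (by ring))
      (fe (b := v) (by ring))
      (fo (b := u) (by ring))
      (fe (b := u + v + γ) (by ring))
      (fe (b := γ) (by ring))
      (fe (b := θ + v) (by ring))
      (fo (b := θ + u) (by ring))
    linear_combination (1 : ℂ) * h
  have T110101 : f (θ + v + γ) * f (u + γ) * f (u + v) * f θ - f (θ + γ) * f (θ + v) * f u * f (u + v + γ) - f (θ - u) * f γ * f v * f (θ + u + v + γ) = 0 := by
    have h := W3 ((θ + u + v + 2 * γ) / 2) ((θ - u + v) / 2) ((θ + u + v) / 2) ((-θ + u + v) / 2)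
      (fe (b := θ + v + γ) (by ring))
      (fe (b := u + γ) (by ring))
      (fe (b := u + v) (by ring))
      (fe (b := θ) (by ring))
      (fe (b := θ + u + v + γ) (by ring))
      (fe (b := γ) (by ring))
      (fe (b := v) (by ring))
      (fe (b := θ - u) (by ring))
      (fe (b := u + v + γ) (by ring))
      (fe (b := θ + γ) (by ring))
      (fe (b := θ + v) (by ring))
      (fo (b := u) (by ring))
    linear_combination (1 : ℂ) * h
  have hm : θ - γ * 1 = θ - γ := by ring
  have hp : θ - γ * -1 = θ + γ := by ring
  have r1 : θ - γ + u = θ + u - γ := by ring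
  have r2 : θ - γ + v = θ + v - γ := by ring
  have r3 : θ - γ + (u + v) = θ + u + v - γ := by ring
  have r4 : θ - γ + γ = θ := by ring
  have r5 : θ - γ - u = θ - u - γ := by ring
  have r6 : θ - γ - v = θ - v - γ := by ring
  have r7 : θ - γ - (u + v) = θ - u - v - γ := by ring
  have r8 : θ - γ - γ = θ - 2 * γ := by ring
  have r9 : θ + γ + u = θ + u + γ := by ring
  have r10 : θ + γ + v = θ + v + γ := by ring
  have r11 : θ + γ + (u + v) = θ + u + v + γ := by ring
  have r12 : θ + γ + γ = θ + 2 * γ := by ring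
  have r13 : θ + γ - u = θ - u + γ := by ring
  have r14 : θ + γ - v = θ - v + γ := by ring
  have r15 : θ + γ - (u + v) = θ - u - v + γ := by ring
  have r16 : θ + γ - γ = θ := by ring
  have r17 : θ + (u + v) = θ + u + v := by ring
  have r18 : θ - (u + v) = θ - u - v := by ring
  ext ⟨i1, i2, i3⟩ ⟨j1, j2, j3⟩
  simp only [Matrix.mul_apply, Fintype.sum_prod_type, Fin.sum_univ_two, R12dynH3, R13dyn, R23dynH1,
    R23dyn, R13dynH2, R12dyn]
  fin_cases i1 <;> fin_cases i2 <;> fin_cases i3 <;> fin_cases j1 <;> fin_cases j2 <;> fin_cases j3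
  all_goals
    simp only [Fin.zero_eta, Fin.mk_one]
    try simp only [hRaw, e0, e1, hm, hp, Fin.isValue, zero_ne_one, one_ne_zero, and_true, true_and, and_false, false_and, and_self,
      if_true, if_false, ↓reduceIte, mul_zero, zero_mul, add_zero, zero_add, mul_one, r1, r2, r3, r4, r5, r6, r7, r8, r9, r10, r11, r12, r13, r14, r15, r16, r17, r18]
  · -- entry (0, 0, 0), (0, 0, 0)
    field_simp
  · -- entry (0, 0, 1), (0, 0, 1)
    field_simp
  · -- entry (0, 0, 1), (0, 1, 0)
    field_simp
    linear_combination (f γ) * T001010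
  · -- entry (0, 0, 1), (1, 0, 0)
    field_simp
    linear_combination (f γ) * T001100
  · -- entry (0, 1, 0), (0, 0, 1)
    field_simp
    try simp only [mul_comm γ 2]
    linear_combination (f (θ - 2 * γ) * f γ) * T010001
  · -- entry (0, 1, 0), (0, 1, 0)
    field_simp
    try simp only [mul_comm γ 2]
    linear_combination (f u * f v * f (u + v + γ)) * T010010a + f γ ^ 3 * T010010b
  · -- entry (0, 1, 0), (1, 0, 0)
    field_simp
    linear_combination (f γ) * T010100
  · -- entry (0, 1, 1), (0, 1, 1)
    field_simp
  · -- entry (0, 1, 1), (1, 0, 1)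
    field_simp
    linear_combination (f γ) * T011101
  · -- entry (0, 1, 1), (1, 1, 0)
    field_simp
    try simp only [mul_comm γ 2]
    linear_combination (f γ) * T011110
  · -- entry (1, 0, 0), (0, 0, 1)
    field_simp
    try simp only [mul_comm γ 2]
    linear_combination (f γ) * T100001
  · -- entry (1, 0, 0), (0, 1, 0)
    field_simp
    linear_combination (f γ) * T100010
  · -- entry (1, 0, 0), (1, 0, 0)
    field_simp
  · -- entry (1, 0, 1), (0, 1, 1)
    field_simp
    linear_combination (f γ) * T101011
  · -- entry (1, 0, 1), (1, 0, 1)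
    field_simp
    try simp only [mul_comm γ 2]
    linear_combination (f u * f v * f (u + v + γ)) * T101101a + f γ ^ 3 * T101101b
  · -- entry (1, 0, 1), (1, 1, 0)
    field_simp
    try simp only [mul_comm γ 2]
    linear_combination (f γ * f (θ + 2 * γ)) * T101110
  · -- entry (1, 1, 0), (0, 1, 1)
    field_simp
    linear_combination (f γ) * T110011
  · -- entry (1, 1, 0), (1, 0, 1)
    field_simp
    linear_combination (f γ) * T110101
  · -- entry (1, 1, 0), (1, 1, 0)
    field_simp
  · -- entry (1, 1, 1), (1, 1, 1)
    field_simp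

end
end
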